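/- arXiv:2202.00854 — 2 statements merged into one kernel-verified Lean document; each statement's English description precedes it below -/
import Mathlib

section
/- Let G be a proper circular-arc graph. If the complement of G is not connected, then the complement of G is a bipartite permutation graph. -/
/-! Common definitions: arc/interval representations, graph classes,
induced subgraph containment, small named graphs, reduced graphs. -/

/-- The point of the unit circle corresponding to parameter `t`. -/
noncomputable def circlePt (t : ℝ) : ℝ × ℝ :=
  (Real.cos (2 * Real.pi * t), Real.sin (2 * Real.pi * t))

/-- A (nonempty closed) arc of the unit circle: the image under
`t ↦ (cos 2πt, sin 2πt)` of a closed interval `[a, b] ⊆ ℝ` with `0 ≤ b - a < 1`. -/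
def IsUnitCircleArc (A : Set (ℝ × ℝ)) : Prop :=
  ∃ a b : ℝ, 0 ≤ b - a ∧ b - a < 1 ∧ A = circlePt '' Set.Icc a b

/-- An arc representation of a graph: each vertex gets an arc of the unit circle,
and two distinct vertices are adjacent iff their arcs intersect. -/
def IsArcRep {V : Type*} (G : SimpleGraph V) (f : V → Set (ℝ × ℝ)) : Prop :=
  (∀ v, IsUnitCircleArc (f v)) ∧
    ∀ u v : V, u ≠ v → (G.Adj u v ↔ (f u ∩ f v).Nonempty)

/-- A family of sets is proper if no member is properly contained in another. -/
def ProperFamily {V α : Type*} (f : V → Set α) : Prop :=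
  ∀ u v : V, ¬ f u ⊂ f v

/-- A family of sets is Helly if every subfamily of pairwise intersecting sets
has a common point. -/
def HellyFamily {V α : Type*} (f : V → Set α) : Prop :=
  ∀ S : Set V, (∀ u ∈ S, ∀ v ∈ S, (f u ∩ f v).Nonempty) → (⋂ v ∈ S, f v).Nonempty

/-- A proper circular-arc graph: admits an arc representation with no arc
properly contained in another. -/
def IsProperCircularArcGraph {V : Type*} (G : SimpleGraph V) : Prop :=
  ∃ f : V → Set (ℝ × ℝ), IsArcRep G f ∧ ProperFamily f

/-- A proper Helly circular-arc graph: admits an arc representation that is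
simultaneously proper and Helly. -/
def IsProperHellyCircularArcGraph {V : Type*} (G : SimpleGraph V) : Prop :=
  ∃ f : V → Set (ℝ × ℝ), IsArcRep G f ∧ ProperFamily f ∧ HellyFamily f

/-- An interval representation: each vertex gets a nonempty closed bounded
interval of ℝ; distinct vertices adjacent iff intervals intersect. -/
def IsIntervalRep {V : Type*} (G : SimpleGraph V) (f : V → Set ℝ) : Prop :=
  (∀ v, ∃ a b : ℝ, a ≤ b ∧ f v = Set.Icc a b) ∧
    ∀ u v : V, u ≠ v → (G.Adj u v ↔ (f u ∩ f v).Nonempty)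

def IsIntervalGraph {V : Type*} (G : SimpleGraph V) : Prop :=
  ∃ f : V → Set ℝ, IsIntervalRep G f

def IsProperIntervalGraph {V : Type*} (G : SimpleGraph V) : Prop :=
  ∃ f : V → Set ℝ, IsIntervalRep G f ∧ ProperFamily f

/-- A graph is bipartite: its vertices can be partitioned into two independent sets. -/
def IsBipartite {V : Type*} (G : SimpleGraph V) : Prop :=
  ∃ c : V → Bool, ∀ u v : V, G.Adj u v → c u ≠ c v

/-- A permutation graph. -/
def IsPermutationGraph {V : Type*} (G : SimpleGraph V) : Prop :=
  ∃ a b : V → ℝ, Function.Injective a ∧ Function.Injective b ∧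
    ∀ u v : V, u ≠ v → (G.Adj u v ↔ (a u - a v) * (b u - b v) < 0)

def IsBipartitePermutationGraph {V : Type*} (G : SimpleGraph V) : Prop :=
  IsPermutationGraph G ∧ IsBipartite G

/-- `f : ZMod ℓ → V` is an induced (chordless) cycle of length `ℓ ≥ 3` in `G`:
`f` is injective and two images are adjacent iff their indices are consecutive mod `ℓ`. -/
def IsInducedCycle {V : Type*} (G : SimpleGraph V) (ℓ : ℕ) (f : ZMod ℓ → V) : Prop :=
  3 ≤ ℓ ∧ Function.Injective f ∧
    ∀ i j : ZMod ℓ, G.Adj (f i) (f j) ↔ (i = j + 1 ∨ j = i + 1)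

/-- `G` contains `H` as an induced subgraph. -/
def ContainsInduced {V W : Type*} (G : SimpleGraph V) (H : SimpleGraph W) : Prop :=
  ∃ f : W → V, Function.Injective f ∧ ∀ u v : W, H.Adj u v ↔ G.Adj (f u) (f v)

/-- `G` contains `C_ℓ*`: an induced cycle of length `ℓ` together with a vertex
adjacent to no vertex of the cycle. -/
def HasCycleStar {V : Type*} (G : SimpleGraph V) (ℓ : ℕ) : Prop :=
  ∃ (f : ZMod ℓ → V) (v : V), IsInducedCycle G ℓ f ∧ ∀ i : ZMod ℓ, ¬ G.Adj v (f i)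

/-- A maximal clique. -/
def IsMaxClique {V : Type*} (G : SimpleGraph V) (s : Set V) : Prop :=
  G.IsClique s ∧ ∀ t : Set V, G.IsClique t → s ⊆ t → t = s

/-- A clique path: a linear arrangement of all maximal cliques of `G` such that
the cliques containing any fixed vertex are consecutive. -/
def IsCliquePath {W : Type*} (G : SimpleGraph W) (q : ℕ) (K : Fin q → Set W) : Prop :=
  Function.Injective K ∧ (∀ i, IsMaxClique G (K i)) ∧
    (∀ s : Set W, IsMaxClique G s → ∃ i, K i = s) ∧
    ∀ (v : W) (i j k : Fin q), i ≤ j → j ≤ k → v ∈ K i → v ∈ K k → v ∈ K j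

/-- A circular interval of residues mod `n`: `{p, p+1, …, p+m}`. -/
def IsCircInterval {n : ℕ} (s : Set (ZMod n)) : Prop :=
  ∃ (p : ZMod n) (m : ℕ), s = {x : ZMod n | ∃ k : ℕ, k ≤ m ∧ x = p + (k : ZMod n)}

/-! ### Small named graphs -/

/-- The claw `K_{1,3}`. -/
def clawG : SimpleGraph (Fin 4) := SimpleGraph.fromRel (fun u _ => u = 0)

/-- The net: a triangle `{0,1,2}` with pendant vertices `3,4,5` attached to
`0,1,2` respectively. -/
def netG : SimpleGraph (Fin 6) :=
  SimpleGraph.fromRel (fun u v => (u.val < 3 ∧ v.val < 3) ∨ v.val = u.val + 3)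

/-- The tent `S_3`: triangle `{0,1,2}`, independent set `{3,4,5}`, with
`3 ~ 0,1`, `4 ~ 1,2`, `5 ~ 2,0`. -/
def tentS3 : SimpleGraph (Fin 6) :=
  SimpleGraph.fromRel (fun u v =>
    (u.val < 3 ∧ v.val < 3) ∨ (u = 3 ∧ (v = 0 ∨ v = 1)) ∨
      (u = 4 ∧ (v = 1 ∨ v = 2)) ∨ (u = 5 ∧ (v = 2 ∨ v = 0)))

/-- `S_3*`: the tent together with an isolated vertex `6`. -/
def S3star : SimpleGraph (Fin 7) :=
  SimpleGraph.fromRel (fun u v =>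
    (u.val < 3 ∧ v.val < 3) ∨ (u = 3 ∧ (v = 0 ∨ v = 1)) ∨
      (u = 4 ∧ (v = 1 ∨ v = 2)) ∨ (u = 5 ∧ (v = 2 ∨ v = 0)))

/-- The complement of `S_3*`. -/
def compS3star : SimpleGraph (Fin 7) := S3starᶜ

/-- The complement of `C_4*`: two edges `0-2`, `1-3` plus a universal vertex `4`. -/
def compC4star : SimpleGraph (Fin 5) :=
  SimpleGraph.fromRel (fun u v => (u = 0 ∧ v = 2) ∨ (u = 1 ∧ v = 3) ∨ u = 4)

/-- The chordless cycle `C_6`. -/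
def cycle6G : SimpleGraph (Fin 6) :=
  SimpleGraph.fromRel (fun u v => v.val = (u.val + 1) % 6)

/-- The complement of `C_6`. -/
def compC6 : SimpleGraph (Fin 6) := cycle6Gᶜ

/-- The wheel `W_4`: a `C_4` on `{0,1,2,3}` plus a hub `4`. -/
def W4G : SimpleGraph (Fin 5) :=
  SimpleGraph.fromRel (fun u v => (u.val < 4 ∧ v.val = (u.val + 1) % 4) ∨ v = 4)

/-- The wheel `W_5`: a `C_5` on `{0,…,4}` plus a hub `5`. -/
def W5G : SimpleGraph (Fin 6) :=
  SimpleGraph.fromRel (fun u v => (u.val < 5 ∧ v.val = (u.val + 1) % 5) ∨ v = 5)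

/-- `F_1` (the long claw): the claw with each edge subdivided once. -/
def F1G : SimpleGraph (Fin 7) :=
  SimpleGraph.fromRel (fun u v =>
    (u = 0 ∧ v = 1) ∨ (u = 1 ∧ v = 2) ∨ (u = 0 ∧ v = 3) ∨ (u = 3 ∧ v = 4) ∨
      (u = 0 ∧ v = 5) ∨ (u = 5 ∧ v = 6))

/-- `F_2`: a `C_4` `0-1-2-3-0` with pendant vertices `4,5,6` attached to `0,2,3`. -/
def F2G : SimpleGraph (Fin 7) :=
  SimpleGraph.fromRel (fun u v =>
    (u = 0 ∧ v = 1) ∨ (u = 1 ∧ v = 2) ∨ (u = 2 ∧ v = 3) ∨ (u = 3 ∧ v = 0) ∨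
      (u = 0 ∧ v = 4) ∨ (u = 2 ∧ v = 5) ∨ (u = 3 ∧ v = 6))

/-- `F_3`: a `C_6` `0-1-2-3-4-5-0` with chord `0-3` and pendant `6` at `0`. -/
def F3G : SimpleGraph (Fin 7) :=
  SimpleGraph.fromRel (fun u v =>
    (u.val < 6 ∧ v.val = (u.val + 1) % 6) ∨ (u = 0 ∧ v = 3) ∨ (u = 0 ∧ v = 6))

/-- `F_4`: a `C_6` `0-1-2-3-4-5-0` with chord `0-3` and a vertex `6` adjacent
exactly to `0` and `3`. -/
def F4G : SimpleGraph (Fin 7) :=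
  SimpleGraph.fromRel (fun u v =>
    (u.val < 6 ∧ v.val = (u.val + 1) % 6) ∨ (u = 0 ∧ v = 3) ∨ (u = 6 ∧ (v = 0 ∨ v = 3)))

/-- A reduced graph: connected, co-connected, and containing none of
`C_3*`, `C_5*`, the complement of `C_4*`, `C_6`, `S_3`, the complement of `S_3*`,
`F_1`, `F_2`, `F_3`, `F_4` as induced subgraphs. -/
def IsReducedGraph {V : Type*} (R : SimpleGraph V) : Prop :=
  R.Connected ∧ Rᶜ.Connected ∧
    ¬ HasCycleStar R 3 ∧ ¬ HasCycleStar R 5 ∧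
    ¬ ContainsInduced R compC4star ∧
    ¬ (∃ f : ZMod 6 → V, IsInducedCycle R 6 f) ∧
    ¬ ContainsInduced R tentS3 ∧
    ¬ ContainsInduced R compS3star ∧
    ¬ ContainsInduced R F1G ∧ ¬ ContainsInduced R F2G ∧
    ¬ ContainsInduced R F3G ∧ ¬ ContainsInduced R F4G

theorem circlePt_eq_iff (x y : ℝ) : circlePt x = circlePt y ↔ ∃ n : ℤ, x = y + n := by
  have hpi := Real.pi_pos
  constructor
  · intro h
    have h1 := congrArg Prod.fst h
    have h2 := congrArg Prod.snd h
    obtain ⟨n, hn⟩ := Real.Angle.angle_eq_iff_two_pi_dvd_sub.1 (Real.Angle.cos_sin_inj h1 h2)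
    refine ⟨n, ?_⟩
    have h3 : 2 * Real.pi * (x - (y + n)) = 0 := by linarith
    have h4 := (mul_eq_zero.1 h3).resolve_left (by positivity)
    linarith
  · rintro ⟨n, rfl⟩
    have h : 2 * Real.pi * (y + n) = 2 * Real.pi * y + n * (2 * Real.pi) := by ring
    simp [circlePt, h, Real.cos_add_int_mul_two_pi, Real.sin_add_int_mul_two_pi]

/-- Every point of the circle has a parameter in `[s, s + 1)`. -/
theorem exists_circlePt_eq (s t : ℝ) : ∃ t' ∈ Set.Ico s (s + 1), circlePt t' = circlePt t := by
  refine ⟨toIcoMod one_pos s t, toIcoMod_mem_Ico one_pos s t, ?_⟩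
  refine (circlePt_eq_iff _ _).2 ⟨-toIcoDiv one_pos s t, ?_⟩
  have := toIcoMod_add_toIcoDiv_zsmul (one_pos : (0 : ℝ) < 1) s t
  simp at this
  push_cast
  linarith

/-- The trace of an arc on the fundamental domain `[s, s + 1)`: if `c = true` the arc contains the
point of parameter `s` and its complement is the open interval `(α, β)`; if `c = false` the arc is
the interval `[α, β]`, which avoids `s`. -/
def IsArcTrace (s : ℝ) (A : Set (ℝ × ℝ)) (c : Bool) (α β : ℝ) : Prop :=
  (c = true ∧ s ≤ α ∧ α < β ∧ β ≤ s + 1 ∧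
      ∀ t ∈ Set.Ico s (s + 1), circlePt t ∈ A ↔ t ≤ α ∨ β ≤ t) ∨
    (c = false ∧ s < α ∧ α ≤ β ∧ β < s + 1 ∧
      ∀ t ∈ Set.Ico s (s + 1), circlePt t ∈ A ↔ α ≤ t ∧ t ≤ β)

theorem IsUnitCircleArc.exists_trace {A : Set (ℝ × ℝ)} (hA : IsUnitCircleArc A) (s : ℝ) :
    ∃ c α β, IsArcTrace s A c α β := by
  obtain ⟨a, b, h0, h1, rfl⟩ := hA
  obtain ⟨m, hm1, hm2⟩ : ∃ m : ℤ, s < a - m ∧ a - m ≤ s + 1 := by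
    have h := toIocMod_mem_Ioc (one_pos : (0 : ℝ) < 1) s a
    have h' := toIocMod_add_toIocDiv_zsmul (one_pos : (0 : ℝ) < 1) s a
    simp at h'
    exact ⟨toIocDiv one_pos s a, by linarith [h.1], by linarith [h.2]⟩
  have key : ∀ t ∈ Set.Ico s (s + 1), circlePt t ∈ circlePt '' Set.Icc a b ↔
      (a - m ≤ t ∧ t ≤ b - m) ∨ (a - m ≤ t + 1 ∧ t + 1 ≤ b - m) := by
    rintro t ⟨ht1, ht2⟩
    constructor
    · rintro ⟨z, ⟨hz1, hz2⟩, hz⟩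
      obtain ⟨n, rfl⟩ := (circlePt_eq_iff _ _).1 hz
      have hlo : (-1 : ℝ) < ((n - m : ℤ) : ℝ) := by push_cast; linarith
      have hhi : ((n - m : ℤ) : ℝ) < 2 := by push_cast; linarith
      have hlo' : -1 < n - m := by exact_mod_cast hlo
      have hhi' : n - m < 2 := by exact_mod_cast hhi
      obtain h | h : n - m = 0 ∨ n - m = 1 := by omega
      · obtain rfl : n = m := by omega
        left; constructor <;> linarith
      · obtain rfl : n = m + 1 := by omega
        push_cast at *
        right; constructor <;> linarith
    · rintro (h | h)
      · exact ⟨t + m, ⟨by linarith, by linarith⟩, (circlePt_eq_iff _ _).2 ⟨m, rfl⟩⟩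
      · refine ⟨t + 1 + m, ⟨by linarith, by linarith⟩, (circlePt_eq_iff _ _).2 ⟨m + 1, ?_⟩⟩
        push_cast; ring
  by_cases hb : b - m < s + 1
  · refine ⟨false, a - m, b - m, Or.inr ⟨rfl, hm1, by linarith, hb, fun t ht ↦ ?_⟩⟩
    rw [key t ht]
    refine or_iff_left ?_
    rintro ⟨-, h⟩
    linarith [ht.1]
  · refine ⟨true, b - m - 1, a - m, Or.inl ⟨rfl, by linarith, by linarith, hm2, fun t ht ↦ ?_⟩⟩
    rw [key t ht]
    constructor
    · rintro (h | h)
      · right; linarith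
      · left; linarith
    · rintro (h | h)
      · right; constructor <;> linarith [ht.1]
      · left; constructor <;> linarith [ht.2]

theorem IsUnitCircleArc.exists_param {A : Set (ℝ × ℝ)} (hA : IsUnitCircleArc A) (s : ℝ)
    {p : ℝ × ℝ} (hp : p ∈ A) : ∃ t ∈ Set.Ico s (s + 1), circlePt t = p := by
  obtain ⟨a, b, -, -, rfl⟩ := hA
  obtain ⟨t, -, rfl⟩ := hp
  exact exists_circlePt_eq s t

/-- A criterion for strict inclusion of arcs in terms of parameters in `[s, s + 1)`. -/
theorem IsUnitCircleArc.ssubset {A B : Set (ℝ × ℝ)} (hA : IsUnitCircleArc A) {s t₀ : ℝ}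
    (h : ∀ t ∈ Set.Ico s (s + 1), circlePt t ∈ A → circlePt t ∈ B)
    (hB : circlePt t₀ ∈ B) (hnA : circlePt t₀ ∉ A) : A ⊂ B := by
  refine ⟨fun p hp ↦ ?_, fun hBA ↦ hnA (hBA hB)⟩
  obtain ⟨t, ht, rfl⟩ := hA.exists_param s hp
  exact h t ht hp

/-- For incomparable arcs of the same kind, the traces are ordered consistently. -/
theorem IsArcTrace.lt_iff_lt {s : ℝ} {A A' : Set (ℝ × ℝ)} {c : Bool} {α β α' β' : ℝ}
    (hA : IsUnitCircleArc A) (hA' : IsUnitCircleArc A')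
    (h : IsArcTrace s A c α β) (h' : IsArcTrace s A' c α' β')
    (h1 : ¬ A ⊂ A') (h2 : ¬ A' ⊂ A) : α < α' ↔ β < β' := by
  rcases h with ⟨rfl, ha, hb, hc, hd⟩ | ⟨rfl, ha, hb, hc, hd⟩ <;>
  rcases h' with ⟨hx, ha', hb', hc', hd'⟩ | ⟨hx, ha', hb', hc', hd'⟩ <;>
  first | (exact absurd hx (by decide)) | skip
  · constructor
    · intro hlt
      by_contra! hle
      refine h1 (hA.ssubset (s := s) (t₀ := α') (fun t ht hm ↦ ?_) ?_ ?_)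
      · rw [hd' t ht]
        rcases (hd t ht).1 hm with h | h
        · left; linarith
        · right; linarith
      · rw [hd' α' ⟨ha', by linarith⟩]; left; exact le_rfl
      · rw [hd α' ⟨ha', by linarith⟩]; push Not; constructor <;> linarith
    · intro hlt
      by_contra! hle
      refine h2 (hA'.ssubset (s := s) (t₀ := β) (fun t ht hm ↦ ?_) ?_ ?_)
      · rw [hd t ht]
        rcases (hd' t ht).1 hm with h | h
        · left; linarith
        · right; linarith
      · rw [hd β ⟨by linarith, by linarith⟩]; right; exact le_rfl
      · rw [hd' β ⟨by linarith, by linarith⟩]; push Not; constructor <;> linarith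
  · constructor
    · intro hlt
      by_contra! hle
      refine h2 (hA'.ssubset (s := s) (t₀ := α) (fun t ht hm ↦ ?_) ?_ ?_)
      · rw [hd t ht]
        have := (hd' t ht).1 hm
        constructor <;> linarith
      · rw [hd α ⟨by linarith, by linarith⟩]; exact ⟨le_rfl, hb⟩
      · rw [hd' α ⟨by linarith, by linarith⟩]; rintro ⟨h, -⟩; linarith
    · intro hlt
      by_contra! hle
      refine h1 (hA.ssubset (s := s) (t₀ := β') (fun t ht hm ↦ ?_) ?_ ?_)
      · rw [hd' t ht]
        have := (hd t ht).1 hm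
        constructor <;> linarith
      · rw [hd' β' ⟨by linarith, by linarith⟩]; exact ⟨hb', le_rfl⟩
      · rw [hd β' ⟨by linarith, by linarith⟩]; rintro ⟨-, h⟩; linarith

theorem IsArcTrace.disjoint_iff {s : ℝ} {A A' : Set (ℝ × ℝ)} {α β α' β' : ℝ}
    (hA' : IsUnitCircleArc A')
    (h : IsArcTrace s A true α β) (h' : IsArcTrace s A' false α' β') :
    ¬ (A ∩ A').Nonempty ↔ α < α' ∧ β' < β := by
  rcases h with ⟨-, ha, hb, hc, hd⟩ | ⟨hx, -⟩
  swap
  · exact absurd hx (by decide)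
  rcases h' with ⟨hx, -⟩ | ⟨-, ha', hb', hc', hd'⟩
  · exact absurd hx (by decide)
  constructor
  · intro hne
    constructor <;> by_contra! hle
    · have hI : α' ∈ Set.Ico s (s + 1) := ⟨by linarith, by linarith⟩
      exact hne ⟨circlePt α', (hd _ hI).2 (Or.inl hle), (hd' _ hI).2 ⟨le_rfl, hb'⟩⟩
    · have hI : β' ∈ Set.Ico s (s + 1) := ⟨by linarith, by linarith⟩
      exact hne ⟨circlePt β', (hd _ hI).2 (Or.inr hle), (hd' _ hI).2 ⟨hb', le_rfl⟩⟩
  · rintro ⟨h1, h2⟩ ⟨p, hp, hp'⟩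
    obtain ⟨t, ht, rfl⟩ := hA'.exists_param s hp'
    have h3 := (hd' t ht).1 hp'
    rcases (hd t ht).1 hp with h | h <;> linarith

/-- An arc that meets the arc `[s, e]`, avoids its left end and is not properly contained in it
covers its right end. -/
theorem IsArcTrace.circlePt_mem {s e : ℝ} {A : Set (ℝ × ℝ)} {α β : ℝ}
    (hA : IsUnitCircleArc A) (h : IsArcTrace s A false α β) (hse : s ≤ e) (hes : e < s + 1)
    (hmeet : (A ∩ circlePt '' Set.Icc s e).Nonempty)
    (hprop : ¬ A ⊂ circlePt '' Set.Icc s e) : circlePt e ∈ A := by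
  rcases h with ⟨hx, -⟩ | ⟨-, ha, hb, hc, hd⟩
  · exact absurd hx (by decide)
  rw [hd e ⟨hse, hes⟩]
  constructor
  · obtain ⟨p, hp, t, ht, rfl⟩ := hmeet
    have := (hd t ⟨ht.1, by linarith [ht.2]⟩).1 hp
    linarith [ht.2]
  · by_contra! hlt
    refine hprop (hA.ssubset (s := s) (t₀ := s) (fun t ht hm ↦ ?_) ?_ ?_)
    · exact ⟨t, ⟨ht.1, by linarith [((hd t ht).1 hm).2]⟩, rfl⟩
    · exact ⟨s, ⟨le_rfl, hse⟩, rfl⟩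
    · rw [hd s ⟨le_rfl, by linarith⟩]; rintro ⟨h, -⟩; linarith

theorem exists_real_of_injective {V L : Type*} [Finite V] [LinearOrder L] (key : V → L)
    (hkey : Function.Injective key) :
    ∃ a : V → ℝ, Function.Injective a ∧ ∀ u v, a u < a v ↔ key u < key v := by
  have : Countable (Set.range key) := (Set.finite_range key).countable.to_subtype
  obtain ⟨g⟩ := Order.embedding_from_countable_to_dense (Set.range key) ℝ
  refine ⟨fun v ↦ g ⟨key v, Set.mem_range_self v⟩, fun u v h ↦ ?_, fun u v ↦ ?_⟩
  · exact hkey (congrArg Subtype.val (g.injective h))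
  · exact g.lt_iff_lt

/-- A two-line criterion for bipartite permutation graphs in which ties are allowed: `k` separates
components, `c` is a proper 2-colouring, and `α`, `β` give the positions on the two lines. -/
theorem isBipartitePermutationGraph_of_order {V : Type*} [Finite V] (H : SimpleGraph V)
    (k : V → ℕ) (c : V → Bool) (α β : V → ℝ)
    (hk : ∀ u v, H.Adj u v → k u = k v)
    (hc : ∀ u v, H.Adj u v → c u ≠ c v)
    (hmono : ∀ u v, k u = k v → c u = c v → (α u < α v ↔ β u < β v))
    (hadj : ∀ u v, k u = k v → c u = true → c v = false →
      (H.Adj u v ↔ α u < α v ∧ β v < β u))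
    (hcov : ∀ u v, u ≠ v → k u = k v → c u = true → c v = false →
      ¬ (α v ≤ α u ∧ β u ≤ β v)) :
    IsBipartitePermutationGraph H := by
  refine ⟨?_, c, hc⟩
  obtain ⟨n, ⟨i⟩⟩ := Finite.exists_equiv_fin V
  obtain ⟨a, ha, ha'⟩ := exists_real_of_injective
    (fun v ↦ toLex (k v, toLex (α v, toLex ((c v).toNat, i v)))) (fun u v h ↦ by simp at h; tauto)
  obtain ⟨b, hb, hb'⟩ := exists_real_of_injective
    (fun v ↦ toLex (k v, toLex (β v, toLex ((!c v).toNat, i v)))) (fun u v h ↦ by simp at h; tauto)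
  refine ⟨a, b, ha, hb, fun u v huv ↦ ?_⟩
  have hi : i u ≠ i v := fun h ↦ huv (i.injective h)
  rw [mul_neg_iff, sub_pos, sub_pos, sub_neg, sub_neg]
  simp only [ha', hb', Prod.Lex.toLex_lt_toLex]
  by_cases hkk : k u = k v
  swap
  · have := mt (hk u v) hkk
    grind
  rcases hcu : c u <;> rcases hcv : c v
  · have := mt (hc u v)
    have := hmono u v hkk (by simp [*])
    have := hmono v u hkk.symm (by simp [*])
    grind
  · have := hadj v u hkk.symm hcv hcu
    have := hcov v u huv.symm hkk.symm hcv hcu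
    have := H.adj_comm u v
    simp
    grind
  · have := hadj u v hkk hcu hcv
    have := hcov u v huv hkk hcu hcv
    simp
    grind
  · have := mt (hc u v)
    have := hmono u v hkk (by simp [*])
    have := hmono v u hkk.symm (by simp [*])
    grind

theorem SimpleGraph.exists_adj_of_connectedComponentMk_eq {V : Type*} {H : SimpleGraph V} {u v : V}
    (huv : u ≠ v) (h : H.connectedComponentMk u = H.connectedComponentMk v) :
    ∃ w, H.Adj u w := by
  obtain ⟨p⟩ := SimpleGraph.ConnectedComponent.exact h
  cases p with
  | nil => exact absurd rfl huv
  | cons hadj _ => exact ⟨_, hadj⟩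

theorem SimpleGraph.exists_connectedComponentMk_ne {V : Type*} {H : SimpleGraph V}
    (h : ¬ H.Connected) (v : V) : ∃ x, H.connectedComponentMk x ≠ H.connectedComponentMk v := by
  by_contra! hall
  have : Nonempty V := ⟨v⟩
  exact h ⟨fun x y ↦ SimpleGraph.ConnectedComponent.exact ((hall x).trans (hall y).symm)⟩

/-- If `G` is a proper circular-arc graph whose complement is not
connected, then the complement of `G` is a bipartite permutation graph. -/
theorem pcag_compl_disconnected_is_bipartite_permutation {V : Type*} [Fintype V]
    (G : SimpleGraph V)
    (hpcag : IsProperCircularArcGraph G) (hdisc : ¬ (Gᶜ).Connected) :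
    IsBipartitePermutationGraph Gᶜ := by
  obtain ⟨f, ⟨harc, hrep⟩, hprop⟩ := hpcag
  have hdis : ∀ u v, u ≠ v → (Gᶜ.Adj u v ↔ ¬ (f u ∩ f v).Nonempty) := fun u v huv ↦ by
    rw [SimpleGraph.compl_adj, hrep u v huv]; tauto
  have hx : ∀ C : Gᶜ.ConnectedComponent, ∃ x, Gᶜ.connectedComponentMk x ≠ C := fun C ↦ by
    induction C using SimpleGraph.ConnectedComponent.ind with
    | h v => exact SimpleGraph.exists_connectedComponentMk_ne hdisc v
  choose x hx using hx
  have harc' := harc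
  choose a b h0 h1 hf using harc'
  let s : V → ℝ := fun v ↦ a (x (Gᶜ.connectedComponentMk v))
  choose c α β htr using fun v ↦ (harc v).exists_trace (s v)
  have hcomp : ∀ u v, Gᶜ.Adj u v → Gᶜ.connectedComponentMk u = Gᶜ.connectedComponentMk v :=
    fun u v h ↦ SimpleGraph.ConnectedComponent.sound h.reachable
  have hs : ∀ u v, Gᶜ.connectedComponentMk u = Gᶜ.connectedComponentMk v → s u = s v :=
    fun u v h ↦ by simp only [s, h]
  have hmono : ∀ u v, Gᶜ.connectedComponentMk u = Gᶜ.connectedComponentMk v → c u = c v →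
      (α u < α v ↔ β u < β v) := fun u v huv hc ↦ by
    have hv := htr v
    rw [← hs u v huv, ← hc] at hv
    exact (htr u).lt_iff_lt (harc u) (harc v) hv (hprop u v) (hprop v u)
  have hend : ∀ v, c v = false →
      circlePt (b (x (Gᶜ.connectedComponentMk v))) ∈ f v := fun v hv ↦ by
    have htv := htr v
    rw [hv] at htv
    have hne : v ≠ x (Gᶜ.connectedComponentMk v) := fun h ↦
      hx (Gᶜ.connectedComponentMk v) (congrArg Gᶜ.connectedComponentMk h).symm
    refine htv.circlePt_mem (harc v) (by linarith [h0 (x (Gᶜ.connectedComponentMk v))])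
      (by linarith [h1 (x (Gᶜ.connectedComponentMk v))]) ?_ ?_
    · rw [← hf]
      by_contra hdisj
      exact hx _ (hcomp _ _ ((hdis _ _ hne).2 hdisj)).symm
    · rw [← hf]
      exact hprop _ _
  have hstart : ∀ v, c v = true → circlePt (s v) ∈ f v := fun v hv ↦ by
    rcases htr v with ⟨-, ha, hb, hc, hd⟩ | ⟨hcv, -⟩
    · exact (hd _ ⟨le_rfl, by linarith⟩).2 (Or.inl ha)
    · simp [hv] at hcv
  have hc : ∀ u v, Gᶜ.Adj u v → c u ≠ c v := fun u v huv hcuv ↦ by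
    refine (hdis u v huv.ne).1 huv ?_
    have huv' := hcomp u v huv
    rcases hcu : c u
    · refine ⟨_, hend u hcu, ?_⟩
      rw [huv']
      exact hend v (hcuv ▸ hcu)
    · refine ⟨_, hstart u hcu, ?_⟩
      rw [hs u v huv']
      exact hstart v (hcuv ▸ hcu)
  have hadj : ∀ u v, Gᶜ.connectedComponentMk u = Gᶜ.connectedComponentMk v → c u = true →
      c v = false → (Gᶜ.Adj u v ↔ α u < α v ∧ β v < β u) := fun u v huv hcu hcv ↦ by
    have hu := htr u
    have hv := htr v
    rw [hcu, hs u v huv] at hu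
    rw [hcv] at hv
    rw [hdis u v (by rintro rfl; simp [hcu] at hcv), hu.disjoint_iff (harc v) hv]
  obtain ⟨n, ⟨i⟩⟩ := Finite.exists_equiv_fin Gᶜ.ConnectedComponent
  have hi : ∀ u v : V, (i (Gᶜ.connectedComponentMk u) : ℕ) = i (Gᶜ.connectedComponentMk v) →
      Gᶜ.connectedComponentMk u = Gᶜ.connectedComponentMk v :=
    fun u v h ↦ i.injective (Fin.ext h)
  refine isBipartitePermutationGraph_of_order Gᶜ (fun v ↦ (i (Gᶜ.connectedComponentMk v) : ℕ))
    c α β (fun u v h ↦ by simp only [hcomp u v h]) hc (fun u v h ↦ hmono u v (hi u v h))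
    (fun u v h ↦ hadj u v (hi u v h)) ?_
  rintro u v huv h hcu hcv ⟨h2, h3⟩
  obtain ⟨w, hw⟩ := SimpleGraph.exists_adj_of_connectedComponentMk_eq huv (hi u v h)
  have hcw : c w = false := by
    have := hc u w hw
    rw [hcu] at this
    simpa using this.symm
  have hlt := (hadj u w (hcomp u w hw) hcu hcw).1 hw
  have := (hmono v w ((hi u v h).symm.trans (hcomp u w hw)) (hcv.trans hcw.symm)).1
    (by linarith [hlt.1])
  linarith [hlt.2]
end

section
/- Every reduced graph R is C_{2ℓ+1}*-free for every ℓ ≥ 1; equivalently, for every induced cycle C of R of odd length and every vertex v of R, either v lies on C or v has a neighbor on C. -/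
/-- In an induced cycle of length at least `7`, every window of six consecutive vertices
induces a path. -/
theorem IsInducedCycle.window {V : Type*} {G : SimpleGraph V} {ℓ : ℕ} {f : ZMod ℓ → V}
    (hf : IsInducedCycle G ℓ f) (hℓ : 7 ≤ ℓ) (i : ZMod ℓ) (a b : ℤ) (hab : |a - b| ≤ 5) :
    (G.Adj (f (i + a)) (f (i + b)) ↔ a = b + 1 ∨ b = a + 1) ∧
      (f (i + a) = f (i + b) ↔ a = b) := by
  have eq_zero : ∀ z : ℤ, |z| ≤ 6 → (z : ZMod ℓ) = 0 → z = 0 := fun z hz h =>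
    Int.eq_zero_of_abs_lt_dvd ((ZMod.intCast_zmod_eq_zero_iff_dvd z ℓ).1 h) (by omega)
  rw [abs_le] at hab
  refine ⟨?_, fun h => ?_, fun h => by rw [h]⟩
  · rw [hf.2.2]
    constructor
    · rintro (h | h)
      · have := eq_zero (a - b - 1) (by rw [abs_le]; omega) (by push_cast; linear_combination h)
        omega
      · have := eq_zero (b - a - 1) (by rw [abs_le]; omega) (by push_cast; linear_combination h)
        omega
    · rintro (rfl | rfl)
      · left; push_cast; ring
      · right; push_cast; ring
  · have h := hf.2.1 h
    have := eq_zero (a - b) (by rw [abs_le]; omega) (by push_cast; linear_combination h)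
    omega

theorem hasCycleStar_three {V : Type*} {G : SimpleGraph V} {a b c v : V}
    (hab : G.Adj a b) (hac : G.Adj a c) (hbc : G.Adj b c)
    (ha : ¬ G.Adj v a) (hb : ¬ G.Adj v b) (hc : ¬ G.Adj v c) : HasCycleStar G 3 := by
  have hinj : ∀ x y : Fin 3, ![a, b, c] x = ![a, b, c] y → x = y := by
    intro x y
    fin_cases x <;> fin_cases y <;>
      simp [hab.ne, hab.ne', hac.ne, hac.ne', hbc.ne, hbc.ne']
  have hadj : ∀ x y : Fin 3, G.Adj (![a, b, c] x) (![a, b, c] y) ↔ x = y + 1 ∨ y = x + 1 := by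
    intro x y
    fin_cases x <;> fin_cases y <;>
      simp [hab, hab.symm, hac, hac.symm, hbc, hbc.symm]
  have hv : ∀ x : Fin 3, ¬ G.Adj v (![a, b, c] x) := by
    intro x
    fin_cases x <;> simp [ha, hb, hc]
  exact ⟨![a, b, c], v, ⟨le_rfl, hinj, hadj⟩, hv⟩

section Obstructions

variable {V : Type*} {R : SimpleGraph V} {p : ℤ → V} {u v : V}

/-- A vertex `u` adjacent to two consecutive vertices of a long
induced path creates a `C_3*` or the complement of a `C_4*`. -/
theorem hasCycleStar_or_containsInduced_compC4star
    (hp : ∀ a b : ℤ, |a - b| ≤ 5 → (R.Adj (p a) (p b) ↔ a = b + 1 ∨ b = a + 1))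
    (hinj : ∀ a b : ℤ, |a - b| ≤ 5 → (p a = p b ↔ a = b))
    (h0 : R.Adj u (p 0)) (h1 : R.Adj u (p 1)) :
    HasCycleStar R 3 ∨ ContainsInduced R compC4star := by
  by_contra! hcon
  have far : ∀ a : ℤ, a = 3 ∨ a = 4 → R.Adj u (p a) := by
    intro a ha
    by_contra hua
    refine hcon.1 (hasCycleStar_three h0 h1 ((hp 0 1 (by norm_num)).2 (by norm_num))
      (mt SimpleGraph.Adj.symm hua) ?_ ?_) <;>
    rcases ha with rfl | rfl <;> simp [hp]
  have h3 := far 3 (.inl rfl)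
  have h4 := far 4 (.inr rfl)
  refine hcon.2 ⟨![p 0, p 3, p 1, p 4, u], ?_, ?_⟩
  · intro x y
    fin_cases x <;> fin_cases y <;>
      simp [h0.ne, h0.ne', h1.ne, h1.ne', h3.ne, h3.ne', h4.ne, h4.ne', hinj]
  · intro x y
    fin_cases x <;> fin_cases y <;>
      simp [compC4star, h0, h1, h3, h4, h0.symm, h1.symm, h3.symm, h4.symm, hp]

theorem containsInduced_F1G
    (hp : ∀ a b : ℤ, |a - b| ≤ 5 → (R.Adj (p a) (p b) ↔ a = b + 1 ∨ b = a + 1))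
    (hinj : ∀ a b : ℤ, |a - b| ≤ 5 → (p a = p b ↔ a = b))
    (hup : ∀ a, u ≠ p a) (hvp : ∀ a, v ≠ p a) (huv : R.Adj u v) (hv : ∀ a, ¬ R.Adj v (p a))
    (h0 : R.Adj u (p 0)) (h1 : ¬ R.Adj u (p 1)) (h1' : ¬ R.Adj u (p (-1)))
    (h2 : ¬ R.Adj u (p 2)) (h2' : ¬ R.Adj u (p (-2))) :
    ContainsInduced R F1G := by
  have hv' : ∀ a, ¬ R.Adj (p a) v := fun a h => hv a h.symm
  refine ⟨![p 0, u, v, p 1, p 2, p (-1), p (-2)], ?_, ?_⟩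
  · intro x y
    fin_cases x <;> fin_cases y <;>
      simp [hup, hvp, huv.ne, huv.ne', (hup _).symm, (hvp _).symm, hinj]
  · intro x y
    fin_cases x <;> fin_cases y <;>
      simp [F1G, h0, h1, h1', h2, h2', hv, hv', huv, huv.symm, hp, R.adj_comm _ u]

theorem containsInduced_F2G
    (hp : ∀ a b : ℤ, |a - b| ≤ 5 → (R.Adj (p a) (p b) ↔ a = b + 1 ∨ b = a + 1))
    (hinj : ∀ a b : ℤ, |a - b| ≤ 5 → (p a = p b ↔ a = b))
    (hup : ∀ a, u ≠ p a) (hvp : ∀ a, v ≠ p a) (huv : R.Adj u v) (hv : ∀ a, ¬ R.Adj v (p a))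
    (h0 : R.Adj u (p 0)) (h1 : ¬ R.Adj u (p 1)) (h1' : ¬ R.Adj u (p (-1)))
    (h2 : R.Adj u (p 2)) (h3 : ¬ R.Adj u (p 3)) :
    ContainsInduced R F2G := by
  have hv' : ∀ a, ¬ R.Adj (p a) v := fun a h => hv a h.symm
  refine ⟨![p 0, p 1, p 2, u, p (-1), p 3, v], ?_, ?_⟩
  · intro x y
    fin_cases x <;> fin_cases y <;>
      simp [hup, hvp, huv.ne, huv.ne', (hup _).symm, (hvp _).symm, hinj]
  · intro x y
    fin_cases x <;> fin_cases y <;>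
      simp [F2G, h0, h1, h1', h2, h3, hv, hv', huv, huv.symm, hp, R.adj_comm _ u]

end Obstructions

/-- A reduced graph is `C_{2ℓ+1}*`-free for every `ℓ ≥ 1`:
for every odd induced cycle and every vertex `v`, either `v` lies on the cycle
or `v` has a neighbor on it. -/
theorem reduced_no_odd_cycle_star {V : Type*} [Fintype V] (R : SimpleGraph V)
    (hR : IsReducedGraph R) :
    ∀ (ℓ : ℕ) (f : ZMod ℓ → V), Odd ℓ → IsInducedCycle R ℓ f →
      ∀ v : V, v ∈ Set.range f ∨ ∃ i : ZMod ℓ, R.Adj v (f i) := by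
  obtain ⟨hconn, -, hC3, hC5, hC4, -, -, -, hF1, hF2, -, -⟩ := hR
  intro ℓ f hodd hf v₀
  by_contra! hv₀
  have hℓ : 7 ≤ ℓ := by
    have h3 : ℓ ≠ 3 := by rintro rfl; exact hC3 ⟨f, v₀, hf, hv₀.2⟩
    have h5 : ℓ ≠ 5 := by rintro rfl; exact hC5 ⟨f, v₀, hf, hv₀.2⟩
    have := hf.1
    obtain ⟨k, rfl⟩ := hodd
    omega
  -- Connectedness provides an edge `v u` where `v` misses the cycle and `u` has a neighbor on it.
  obtain ⟨v, u, hvu, hv, i, hui⟩ :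
      ∃ v u, R.Adj v u ∧ (∀ i, ¬ R.Adj v (f i)) ∧ ∃ i, R.Adj u (f i) := by
    obtain ⟨w⟩ := hconn.preconnected v₀ (f 0)
    obtain ⟨d, -, h₁, h₂⟩ := w.exists_boundary_dart {x | ∀ i, ¬ R.Adj x (f i)} hv₀.2
      (fun h => h 1 ((hf.2.2 0 1).2 (.inr (zero_add 1).symm)))
    simp only [Set.mem_ofPred_eq, not_forall, not_not] at h₁ h₂
    exact ⟨d.fst, d.snd, d.adj, h₁, h₂⟩
  have hup : ∀ j, u ≠ f j := fun j h => hv j (h ▸ hvu)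
  have hvp : ∀ j, v ≠ f j := fun j h =>
    hv (j + 1) (h ▸ (hf.2.2 j (j + 1)).2 (.inr rfl))
  have hp := fun (j : ZMod ℓ) a b hab => (hf.window hℓ j a b hab).1
  have hinj := fun (j : ZMod ℓ) a b hab => (hf.window hℓ j a b hab).2
  have hsucc : ∀ j, R.Adj u (f j) → ¬ R.Adj u (f (j + 1)) := by
    intro j h₀ h₁
    rcases hasCycleStar_or_containsInduced_compC4star (p := fun a : ℤ => f (j + a))
      (hp j) (hinj j) (by simpa using h₀) (by simpa using h₁) with h | h
    · exact hC3 h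
    · exact hC4 h
  have hpred : ∀ j, R.Adj u (f j) → ¬ R.Adj u (f (j + (-1 : ℤ))) := by
    intro j h₀ h₁
    exact hsucc _ h₁ (by simpa using h₀)
  have hskip : ∀ j, R.Adj u (f j) → ¬ R.Adj u (f (j + 2)) := by
    intro j h₀ h₂
    refine hF2 (containsInduced_F2G (p := fun a : ℤ => f (j + a)) (hp j) (hinj j)
      (fun a => hup _) (fun a => hvp _) hvu.symm (fun a => hv _) (by simpa using h₀)
      (by simpa using hsucc j h₀) (hpred j h₀) (by simpa using h₂) ?_)
    have h := hsucc _ h₂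
    rw [add_assoc, two_add_one_eq_three] at h
    exact_mod_cast h
  refine hF1 (containsInduced_F1G (p := fun a : ℤ => f (i + a)) (hp i) (hinj i)
      (fun a => hup _) (fun a => hvp _) hvu.symm (fun a => hv _) (by simpa using hui)
      (by simpa using hsucc i hui) (hpred i hui) (by simpa using hskip i hui) fun h => ?_)
  exact hskip _ h (by simpa using hui)
end
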